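/- Let T be a nondegenerate tetrahedron and 𝔅₃(T) the cubic bubble space { v ∈ P₃(T) : ∫_F v q ds = 0 for all q ∈ P₁(F), all faces F }. Then the divergence of the vector bubble space, div(𝔅₃(T)³), equals the L²-orthogonal complement of the constants in P₂(T), i.e. { p ∈ P₂(T) : ∫_T p dx = 0 }. -/

import Mathlib

open MeasureTheory MvPolynomial
open scoped RealInnerProductSpace

noncomputable section

/-- Euclidean 3-space. -/
abbrev E3 := EuclideanSpace ℝ (Fin 3)

/-- Evaluate a polynomial in 3 variables at a point of `E3`. -/
def evalP (x : E3) (p : MvPolynomial (Fin 3) ℝ) : ℝ :=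
  MvPolynomial.eval (fun j => x j) p

/-- The (closed) facet of the tetrahedron opposite to vertex `i`. -/
def face (a : Fin 4 → E3) (i : Fin 4) : Set E3 :=
  convexHull ℝ (a '' {j | j ≠ i})

/-- The (closed) tetrahedron with vertices `a`. -/
def tetra (a : Fin 4 → E3) : Set E3 :=
  convexHull ℝ (Set.range a)

/-- The reference simplex. -/
def Tri (n : ℕ) : Set (Fin n → ℝ) := {t | (∀ i, 0 ≤ t i) ∧ ∑ i, t i ≤ 1}

/-- Affine parametrization of the simplex with vertices `p`. -/
def psi {n : ℕ} (p : Fin (n + 1) → E3) (t : Fin n → ℝ) : E3 :=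
  p 0 + ∑ j, t j • (p j.succ - p 0)

theorem hull_eq {n : ℕ} (p : Fin (n + 1) → E3) :
    convexHull ℝ (Set.range p) = psi p '' Tri n := by
  classical
  let L : (Fin (n+1) → ℝ) →ₗ[ℝ] E3 := Fintype.linearCombination ℝ p
  have h1 : Set.range p = L '' (Set.range fun i j : Fin (n+1) => if i = j then (1:ℝ) else 0) := by
    rw [← Set.range_comp]
    congr 1
    ext1 i
    simp [L, Fintype.linearCombination_apply]
  rw [h1, ← LinearMap.image_convexHull, convexHull_basis_eq_stdSimplex]
  ext x
  constructor
  · rintro ⟨w, ⟨hw0, hw1⟩, rfl⟩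
    rw [Fin.sum_univ_succ] at hw1
    refine ⟨fun j => w j.succ, ⟨fun i => hw0 _, by linarith [hw0 0]⟩, ?_⟩
    have : w 0 = 1 - ∑ i : Fin n, w i.succ := by linarith
    simp only [psi, L, Fintype.linearCombination_apply, Fin.sum_univ_succ, this, smul_sub,
      Finset.sum_sub_distrib, sub_smul, one_smul, Finset.sum_smul]
    abel
  · rintro ⟨t, ⟨h0, h1⟩, rfl⟩
    refine ⟨Fin.cons (1 - ∑ i, t i) t, ⟨fun i => ?_, ?_⟩, ?_⟩
    · refine Fin.cases ?_ ?_ i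
      · simpa using h1
      · intro i; simpa using h0 i
    · simp [Fin.sum_univ_succ]
    · simp only [psi, L, Fintype.linearCombination_apply, Fin.sum_univ_succ, smul_sub,
        Finset.sum_sub_distrib, sub_smul, one_smul, Finset.sum_smul, Fin.cons_zero, Fin.cons_succ]
      abel

theorem isClosed_Tri (n : ℕ) : IsClosed (Tri n) := by
  have : Tri n = (⋂ i, {t | 0 ≤ t i}) ∩ {t | ∑ i, t i ≤ 1} := by
    ext; simp [Tri]
  rw [this]
  refine IsClosed.inter (isClosed_iInter fun i => ?_) ?_
  · exact isClosed_le (by fun_prop) (by fun_prop)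
  · exact isClosed_le (by fun_prop) (by fun_prop)

theorem isCompact_Tri (n : ℕ) : IsCompact (Tri n) := by
  refine IsCompact.of_isClosed_subset (isCompact_Icc (a := (0 : Fin n → ℝ)) (b := 1))
    (isClosed_Tri n) ?_
  rintro t ⟨h0, h1⟩
  refine ⟨fun i => h0 i, fun i => ?_⟩
  exact le_trans (Finset.single_le_sum (fun j _ => h0 j) (Finset.mem_univ i)) h1

theorem face_integral {n : ℕ} (p : Fin (n + 1) → E3) (hp : AffineIndependent ℝ p) :
    ∃ c : ℝ, c ≠ 0 ∧ ∀ f : E3 → ℝ,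
      ∫ x in convexHull ℝ (Set.range p), f x ∂(μH[(n : ℝ)]) = c * ∫ t in Tri n, f (psi p t) := by
  classical
  let L : (Fin n → ℝ) →ₗ[ℝ] E3 := Fintype.linearCombination ℝ (fun j => p j.succ - p 0)
  have hψ : ∀ t, psi p t = p 0 + L t := fun t => by simp [psi, L, Fintype.linearCombination_apply]
  have hker : L.ker = ⊥ := by
    have h := (affineIndependent_iff_linearIndependent_vsub ℝ p 0).1 hp
    have h2 := h.comp (fun j : Fin n => (⟨j.succ, Fin.succ_ne_zero j⟩ : {x : Fin (n+1) // x ≠ 0}))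
      (fun i j hij => by simpa using hij)
    have h3 : LinearIndependent ℝ (fun j : Fin n => p j.succ - p 0) := h2
    rw [LinearMap.ker_eq_bot']
    intro m hm
    ext i
    exact Fintype.linearIndependent_iff.1 h3 m (by simpa [L, Fintype.linearCombination_apply] using hm) i
  have hψ' : psi p = (fun y => p 0 + y) ∘ L := funext hψ
  have hemb : Topology.IsClosedEmbedding (psi p) := by
    rw [hψ']
    exact (Homeomorph.addLeft (p 0)).isClosedEmbedding.comp
      (LinearMap.isClosedEmbedding_of_injective hker)
  have hme : MeasurableEmbedding (psi p) := hemb.measurableEmbedding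
  obtain ⟨K, -, hK⟩ := LinearMap.exists_antilipschitzWith L hker
  have hK' : AntilipschitzWith K (psi p) := by
    rw [hψ']
    intro x y; simpa using hK x y
  obtain ⟨K2, hK2⟩ : ∃ K2, LipschitzWith K2 (psi p) := by
    have := (LinearMap.toContinuousLinearMap L).lipschitz
    refine ⟨‖LinearMap.toContinuousLinearMap L‖₊, fun x y => ?_⟩
    rw [hψ']
    simpa using this x y
  have hvol : (μH[(n:ℝ)] : Measure (Fin n → ℝ)) = volume := by
    have := hausdorffMeasure_pi_real (ι := Fin n)
    simpa using this
  set μ : Measure E3 := μH[(n : ℝ)] with hμ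
  set ν : Measure (Fin n → ℝ) := μ.comap (psi p) with hν
  have hνa : ∀ s, ν s = μ (psi p '' s) := fun s => hme.comap_apply _ _
  have i1 : IsFiniteMeasureOnCompacts ν := ⟨fun s hs => by
    rw [hνa]
    refine lt_of_le_of_lt (hK2.hausdorffMeasure_image_le (Nat.cast_nonneg n) s) ?_
    rw [hvol]
    exact ENNReal.mul_lt_top (ENNReal.rpow_lt_top_of_nonneg (Nat.cast_nonneg n) (by simp)) hs.measure_lt_top⟩
  have i2 : ν.IsAddLeftInvariant := ⟨fun g => by
    ext s hs
    rw [Measure.map_apply (by fun_prop) hs, hνa, hνa]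
    have : psi p '' s = (fun y => L g + y) '' (psi p '' ((fun x => g + x) ⁻¹' s)) := by
      ext y
      constructor
      · rintro ⟨t, ht, rfl⟩
        refine ⟨psi p (t - g), ⟨t - g, by simpa using ht, rfl⟩, ?_⟩
        simp only [hψ, map_sub]; abel
      · rintro ⟨_, ⟨t, ht, rfl⟩, rfl⟩
        refine ⟨g + t, ht, ?_⟩
        simp only [hψ, map_add]; abel
    rw [this]
    exact ((IsometryEquiv.addLeft (L g)).isometry.hausdorffMeasure_image
      (Or.inl (Nat.cast_nonneg n)) _).symm⟩
  have i3 : ν (Set.univ) ≠ 0 := by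
    intro h0
    rw [hνa] at h0
    have := hK'.le_hausdorffMeasure_image (d := n) (Nat.cast_nonneg n) Set.univ
    rw [hvol, ← hμ, h0] at this
    have h2 := isOpen_univ.measure_ne_zero (volume : Measure (Fin n → ℝ)) Set.univ_nonempty
    simp only [mul_zero, nonpos_iff_eq_zero] at this
    exact h2 this
  set κ := ν.addHaarScalarFactor volume with hκ
  have hκν : ν = κ • volume := Measure.isAddLeftInvariant_eq_smul ν volume
  refine ⟨κ, ?_, fun f => ?_⟩
  · intro h
    rw [NNReal.coe_eq_zero] at h
    rw [hκν, h] at i3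
    simp at i3
  · rw [hull_eq]
    have h1 : μ.restrict (psi p '' Tri n) = (Measure.map (psi p) ν).restrict (psi p '' Tri n) := by
      rw [hν, hme.map_comap, Measure.restrict_restrict_of_subset (Set.image_subset_range _ _)]
    rw [h1, hme.setIntegral_map, Set.preimage_image_eq _ hemb.injective, hκν,
      Measure.restrict_smul, integral_smul_nnreal_measure]
    rfl

theorem slice {n : ℕ} (j : Fin (n + 1)) (f : (Fin (n + 1) → ℝ) → ℝ) (hf : Continuous f) :
    ∫ t in Tri (n + 1), f t
      = ∫ s in Tri n, ∫ u in (0 : ℝ)..(1 - ∑ i, s i), f (j.insertNth u s) := by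
  have hmp := volume_preserving_piFinSuccAbove (fun _ : Fin (n+1) => ℝ) j
  have hm1 : MeasurableSet (Tri (n+1)) := (isClosed_Tri _).measurableSet
  have hm : MeasurableSet (Tri n) := (isClosed_Tri _).measurableSet
  have hint : Integrable ((Tri (n+1)).indicator f) := by
    rw [integrable_indicator_iff hm1]
    exact hf.continuousOn.integrableOn_compact (isCompact_Tri _)
  rw [← integral_indicator hm1, ← integral_indicator hm,
    ← (hmp.symm _).integral_comp (MeasurableEquiv.measurableEmbedding _)]
  have hint2 := (hmp.symm _).integrable_comp_of_integrable hint
  rw [show (volume : Measure (ℝ × (Fin n → ℝ))) = volume.prod volume from rfl]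
  refine (integral_prod_symm _ hint2).trans ?_
  congr 1
  ext s
  have hmem : ∀ u : ℝ, (j.insertNth u s : Fin (n+1) → ℝ) ∈ Tri (n+1) ↔ s ∈ Tri n ∧ u ∈ Set.Icc 0 (1 - ∑ i, s i) := by
    intro u
    simp only [Tri, Set.mem_ofPred_eq, Fin.forall_iff_succAbove j, Fin.sum_univ_succAbove _ j,
      Fin.insertNth_apply_same, Fin.insertNth_apply_succAbove, Set.mem_Icc]
    constructor
    · rintro ⟨⟨h0, h1⟩, h2⟩
      exact ⟨⟨h1, by linarith⟩, h0, by linarith⟩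
    · rintro ⟨⟨h1, h2⟩, h0, h3⟩
      exact ⟨⟨h0, h1⟩, by linarith⟩
  have hfun : ∀ u : ℝ, (Tri (n+1)).indicator f ((MeasurableEquiv.piFinSuccAbove (fun _ => ℝ) j).symm (u, s))
      = (Tri (n+1)).indicator f (j.insertNth u s) := fun u => rfl
  simp only [Function.comp_apply, hfun]
  by_cases hs : s ∈ Tri n
  · rw [Set.indicator_of_mem hs, intervalIntegral.integral_of_le (by linarith [hs.2]),
      ← integral_Icc_eq_integral_Ioc, ← integral_indicator measurableSet_Icc]
    congr 1
    ext u
    by_cases hu : u ∈ Set.Icc 0 (1 - ∑ i, s i)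
    · rw [Set.indicator_of_mem hu, Set.indicator_of_mem ((hmem u).2 ⟨hs, hu⟩)]
    · rw [Set.indicator_of_notMem hu, Set.indicator_of_notMem (fun h => hu ((hmem u).1 h).2)]
  · rw [Set.indicator_of_notMem hs]
    rw [show (fun u : ℝ => (Tri (n+1)).indicator f (j.insertNth u s)) = fun _ => 0 from ?_]
    · simp
    · ext u
      rw [Set.indicator_of_notMem (fun h => hs ((hmem u).1 h).1)]

theorem tri_two (f : (Fin 2 → ℝ) → ℝ) (hf : Continuous f) :
    ∫ t in Tri 2, f t = ∫ u in (0 : ℝ)..1, ∫ v in (0 : ℝ)..(1 - u), f ![u, v] := by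
  rw [slice 1 f hf]
  have hF : ∀ s : Fin 1 → ℝ, (∫ u in (0 : ℝ)..(1 - ∑ i, s i), f ((1 : Fin 2).insertNth u s))
      = ∫ v in (0 : ℝ)..(1 - s 0), f ![s 0, v] := by
    intro s
    simp only [Fin.sum_univ_one]
    congr 1
    ext v
    congr 1
    ext i
    fin_cases i <;> simp [Fin.insertNth, Fin.succAboveCases]
  simp_rw [hF]
  have hc : Continuous fun s : Fin 1 → ℝ => ∫ v in (0 : ℝ)..(1 - s 0), f ![s 0, v] := by
    apply intervalIntegral.continuous_parametric_intervalIntegral_of_continuous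
    · fun_prop
    · fun_prop
  rw [slice 0 _ hc]
  have : Tri 0 = Set.univ := by ext; simp [Tri]
  rw [this]
  have h0 : (volume : Measure (Fin 0 → ℝ)).real Set.univ = 1 := by
    rw [Measure.real, volume_pi, Measure.pi_univ]; simp
  simp [h0]

theorem poly_int (k0 k1 k2 k3 k4 k5 w : ℝ) :
    ∫ v in (0 : ℝ)..w, (k0 + k1 * v + k2 * v ^ 2 + k3 * v ^ 3 + k4 * v ^ 4 + k5 * v ^ 5)
      = k0 * w + k1 * w ^ 2 / 2 + k2 * w ^ 3 / 3 + k3 * w ^ 4 / 4 + k4 * w ^ 5 / 5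
        + k5 * w ^ 6 / 6 := by
  have h : ∀ v ∈ Set.uIcc 0 w, HasDerivAt (fun w : ℝ => k0 * w + k1 * w ^ 2 / 2 + k2 * w ^ 3 / 3
      + k3 * w ^ 4 / 4 + k4 * w ^ 5 / 5 + k5 * w ^ 6 / 6)
      (k0 + k1 * v + k2 * v ^ 2 + k3 * v ^ 3 + k4 * v ^ 4 + k5 * v ^ 5) v := by
    intro v _
    have hp : ∀ (n : ℕ) (k : ℝ), HasDerivAt (fun w : ℝ => k * w ^ n / n) (k * (n * v ^ (n - 1)) / n) v :=
      fun n k => ((hasDerivAt_pow n v).const_mul k).div_const _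
    have := (((((hp 1 k0).add (hp 2 k1)).add (hp 3 k2)).add (hp 4 k3)).add (hp 5 k4)).add (hp 6 k5)
    refine (this.congr_deriv ?_).congr_of_eventuallyEq (Filter.Eventually.of_forall fun w => ?_)
    · push_cast; ring
    · simp only [Pi.add_apply]; push_cast; ring
  rw [intervalIntegral.integral_eq_sub_of_hasDerivAt h]
  · ring
  · exact (by fun_prop : Continuous _).intervalIntegrable _ _

theorem tri_poly (c00 c10 c01 c20 c11 c02 c30 c21 c12 c03 c40 c31 c22 c13 c04 : ℝ)
    (f : (Fin 2 → ℝ) → ℝ) (hf : ∀ s, f s =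
      c00 + c10 * s 0 + c01 * s 1 + c20 * s 0 ^ 2 + c11 * s 0 * s 1 + c02 * s 1 ^ 2 +
      c30 * s 0 ^ 3 + c21 * s 0 ^ 2 * s 1 + c12 * s 0 * s 1 ^ 2 + c03 * s 1 ^ 3 + c40 * s 0 ^ 4 +
      c31 * s 0 ^ 3 * s 1 + c22 * s 0 ^ 2 * s 1 ^ 2 + c13 * s 0 * s 1 ^ 3 + c04 * s 1 ^ 4) :
    ∫ s in Tri 2, f s =
      c00 * (1 / 2) + c10 * (1 / 6) + c01 * (1 / 6) + c20 * (1 / 12) + c11 * (1 / 24) +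
      c02 * (1 / 12) + c30 * (1 / 20) + c21 * (1 / 60) + c12 * (1 / 60) + c03 * (1 / 20) +
      c40 * (1 / 30) + c31 * (1 / 120) + c22 * (1 / 180) + c13 * (1 / 120) + c04 * (1 / 30) := by
  have hfc : Continuous f := by
    rw [show f = _ from funext hf]; fun_prop
  rw [tri_two f hfc]
  have h1 : ∀ u : ℝ, ∫ v in (0 : ℝ)..(1 - u), f ![u, v] =
      (c00 * 1 + c01 * (1 / 2) + c02 * (1 / 3) + c03 * (1 / 4) + c04 * (1 / 5)) +
      (c00 * (-1) + c10 * 1 + c01 * (-1) + c11 * (1 / 2) + c02 * (-1) + c12 * (1 / 3) + c03 * (-1) + c13 * (1 / 4) + c04 * (-1)) * u +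
      (c10 * (-1) + c01 * (1 / 2) + c20 * 1 + c11 * (-1) + c02 * 1 + c21 * (1 / 2) + c12 * (-1) + c03 * (3 / 2) + c22 * (1 / 3) + c13 * (-1) + c04 * 2) * u ^ 2 +
      (c20 * (-1) + c11 * (1 / 2) + c02 * (-1 / 3) + c30 * 1 + c21 * (-1) + c12 * 1 + c03 * (-1) + c31 * (1 / 2) + c22 * (-1) + c13 * (3 / 2) + c04 * (-2)) * u ^ 3 +
      (c30 * (-1) + c21 * (1 / 2) + c12 * (-1 / 3) + c03 * (1 / 4) + c40 * 1 + c31 * (-1) + c22 * 1 + c13 * (-1) + c04 * 1) * u ^ 4 +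
      (c40 * (-1) + c31 * (1 / 2) + c22 * (-1 / 3) + c13 * (1 / 4) + c04 * (-1 / 5)) * u ^ 5 := by
    intro u
    rw [show (fun v : ℝ => f ![u, v]) = fun v : ℝ =>
      (c00 + c10 * u + c20 * u ^ 2 + c30 * u ^ 3 + c40 * u ^ 4) +
      (c01 + c11 * u + c21 * u ^ 2 + c31 * u ^ 3) * v + (c02 + c12 * u + c22 * u ^ 2) * v ^ 2 +
      (c03 + c13 * u) * v ^ 3 + (c04) * v ^ 4 + (0) * v ^ 5 from ?_]
    · rw [poly_int]; ring
    · ext v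
      rw [hf]
      simp only [Matrix.cons_val_zero, Matrix.cons_val_one]
      ring
  simp_rw [h1]
  rw [poly_int]
  ring

theorem mom_symA (α β γ : ℝ) :
    ∫ s in Tri 2, (1 - 4 * (s 0 * s 1 + (s 0 + s 1) * (1 - s 0 - s 1)))
      * (α + β * s 0 + γ * s 1) = 0 := by
  rw [tri_poly (1 * α) ((-4) * α + 1 * β) ((-4) * α + 1 * γ) (4 * α + (-4) * β)
    (4 * α + (-4) * β + (-4) * γ) (4 * α + (-4) * γ) (4 * β) (4 * β + 4 * γ) (4 * β + 4 * γ)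
    (4 * γ) (0) (0) (0) (0) (0) _
    (fun s => by ring)]
  ring

theorem mom_b0_side (α β γ : ℝ) :
    ∫ s in Tri 2, (1 / 20 - (s 0 + s 1) / 5 + s 0 * s 1)
      * (α + β * s 0 + γ * s 1) = 0 := by
  rw [tri_poly ((1 / 20) * α) ((-1 / 5) * α + (1 / 20) * β) ((-1 / 5) * α + (1 / 20) * γ) ((-1 / 5) * β)
    (1 * α + (-1 / 5) * β + (-1 / 5) * γ) ((-1 / 5) * γ) (0) (1 * β) (1 * γ) (0) (0) (0) (0)
    (0) (0) _
    (fun s => by ring)]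
  ring

theorem mom_b0_opp (α β γ : ℝ) :
    ∫ s in Tri 2, (-3 / 20 + (s 0 * s 1 + (s 0 + s 1) * (1 - s 0 - s 1)) - 6 * (s 0 * s 1 * (1 - s 0 - s 1)))
      * (α + β * s 0 + γ * s 1) = 0 := by
  rw [tri_poly ((-3 / 20) * α) (1 * α + (-3 / 20) * β) (1 * α + (-3 / 20) * γ) ((-1) * α + 1 * β)
    ((-7) * α + 1 * β + 1 * γ) ((-1) * α + 1 * γ) ((-1) * β) (6 * α + (-7) * β + (-1) * γ)
    (6 * α + (-1) * β + (-7) * γ) ((-1) * γ) (0) (6 * β) (6 * β + 6 * γ) (6 * γ) (0) _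
    (fun s => by ring)]
  ring

theorem mom_G_zero (α β γ : ℝ) :
    ∫ s in Tri 2, (5 * s 0 ^ 3 - 5 * s 0 ^ 2 + s 0)
      * (α + β * s 0 + γ * s 1) = 0 := by
  rw [tri_poly (0) (1 * α) (0) ((-5) * α + 1 * β) (1 * γ) (0) (5 * α + (-5) * β) ((-5) * γ) (0) (0)
    (5 * β) (5 * γ) (0) (0) (0) _
    (fun s => by ring)]
  ring

theorem mom_G_one (α β γ : ℝ) :
    ∫ s in Tri 2, (5 * s 1 ^ 3 - 5 * s 1 ^ 2 + s 1)
      * (α + β * s 0 + γ * s 1) = 0 := by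
  rw [tri_poly (0) (0) (1 * α) (0) (1 * β) ((-5) * α + 1 * γ) (0) (0) ((-5) * β) (5 * α + (-5) * γ) (0)
    (0) (0) (5 * β) (5 * γ) _
    (fun s => by ring)]
  ring

theorem mom_G_sum (α β γ : ℝ) :
    ∫ s in Tri 2, (5 * (1 - s 0 - s 1) ^ 3 - 5 * (1 - s 0 - s 1) ^ 2 + (1 - s 0 - s 1))
      * (α + β * s 0 + γ * s 1) = 0 := by
  rw [tri_poly (1 * α) ((-6) * α + 1 * β) ((-6) * α + 1 * γ) (10 * α + (-6) * β)
    (20 * α + (-6) * β + (-6) * γ) (10 * α + (-6) * γ) ((-5) * α + 10 * β)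
    ((-15) * α + 20 * β + 10 * γ) ((-15) * α + 10 * β + 20 * γ) ((-5) * α + 10 * γ) ((-5) * β)
    ((-15) * β + (-5) * γ) ((-15) * β + (-15) * γ) ((-5) * β + (-15) * γ) ((-5) * γ) _
    (fun s => by ring)]
  ring


/-! ### Polynomial lemmas -/

theorem td_add {p q : MvPolynomial (Fin 3) ℝ} {n : ℕ} (hp : p.totalDegree ≤ n)
    (hq : q.totalDegree ≤ n) : (p + q).totalDegree ≤ n :=
  (totalDegree_add p q).trans (max_le hp hq)

theorem td_sub {p q : MvPolynomial (Fin 3) ℝ} {n : ℕ} (hp : p.totalDegree ≤ n)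
    (hq : q.totalDegree ≤ n) : (p - q).totalDegree ≤ n :=
  (totalDegree_sub p q).trans (max_le hp hq)

theorem td_mul {p q : MvPolynomial (Fin 3) ℝ} {m n : ℕ} (hp : p.totalDegree ≤ m)
    (hq : q.totalDegree ≤ n) : (p * q).totalDegree ≤ m + n :=
  (totalDegree_mul p q).trans (add_le_add hp hq)

theorem td_C_mul {p : MvPolynomial (Fin 3) ℝ} {n : ℕ} (c : ℝ) (hp : p.totalDegree ≤ n) :
    (C c * p).totalDegree ≤ n := by
  simpa using td_mul (totalDegree_C (σ := Fin 3) c).le hp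

theorem monomial_split (d : Fin 3 →₀ ℕ) (c : ℝ) :
    monomial d c = C c ∨ ∃ k d', monomial d c = X k * monomial d' c ∧ d.degree = d'.degree + 1 := by
  by_cases h : d = 0
  · left; simp [h]
  · right
    obtain ⟨k, hk⟩ := Finsupp.ne_iff.1 h
    have hle : Finsupp.single k 1 ≤ d := by
      rw [Finsupp.single_le_iff]; exact Nat.one_le_iff_ne_zero.2 hk
    have h2 : d = Finsupp.single k 1 + (d - Finsupp.single k 1) := (add_tsub_cancel_of_le hle).symm
    refine ⟨k, d - Finsupp.single k 1, ?_, ?_⟩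
    · rw [X, monomial_mul, ← h2, one_mul]
    · conv_lhs => rw [h2]
      rw [map_add, Finsupp.degree_single, add_comm]

theorem degree_le_of_mem {p : MvPolynomial (Fin 3) ℝ} {n : ℕ} (hp : p.totalDegree ≤ n)
    {d : Fin 3 →₀ ℕ} (hd : d ∈ p.support) : d.degree ≤ n :=
  (le_totalDegree hd).trans hp

theorem mem_deg_one (S : Submodule ℝ (MvPolynomial (Fin 3) ℝ)) (h0 : 1 ∈ S) (h1 : ∀ k, X k ∈ S)
    {p : MvPolynomial (Fin 3) ℝ} (hp : p.totalDegree ≤ 1) : p ∈ S := by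
  have hC : ∀ (c : ℝ) q, q ∈ S → C c * q ∈ S := fun c q hq => by
    rw [← smul_eq_C_mul]; exact S.smul_mem _ hq
  rw [← p.support_sum_monomial_coeff]
  refine S.sum_mem fun d hd => ?_
  have hd1 := degree_le_of_mem hp hd
  rcases monomial_split d (p.coeff d) with h | ⟨k, d', h, hdeg⟩
  · rw [h]; simpa using hC _ _ h0
  · have : d' = 0 := (Finsupp.degree_eq_zero_iff d').1 (by omega)
    rw [h, this, mul_comm]
    exact hC _ _ (h1 k)

theorem mem_deg_two (S : Submodule ℝ (MvPolynomial (Fin 3) ℝ)) (h0 : 1 ∈ S) (h1 : ∀ k, X k ∈ S)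
    (h2 : ∀ k l, X k * X l ∈ S)
    {p : MvPolynomial (Fin 3) ℝ} (hp : p.totalDegree ≤ 2) : p ∈ S := by
  have hC : ∀ (c : ℝ) q, q ∈ S → C c * q ∈ S := fun c q hq => by
    rw [← smul_eq_C_mul]; exact S.smul_mem _ hq
  rw [← p.support_sum_monomial_coeff]
  refine S.sum_mem fun d hd => ?_
  have hd1 := degree_le_of_mem hp hd
  rcases monomial_split d (p.coeff d) with h | ⟨k, d', h, hdeg⟩
  · rw [h]; simpa using hC _ _ h0
  · rcases monomial_split d' (p.coeff d) with h' | ⟨l, d'', h', hdeg'⟩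
    · rw [h, h', mul_comm]
      exact hC _ _ (h1 k)
    · have : d'' = 0 := (Finsupp.degree_eq_zero_iff d'').1 (by omega)
      rw [h, h', this, ← mul_assoc, mul_comm]
      exact hC _ _ (h2 k l)

theorem td_pderiv {p : MvPolynomial (Fin 3) ℝ} {n : ℕ} (hp : p.totalDegree ≤ n + 1) (k : Fin 3) :
    (pderiv k p).totalDegree ≤ n := by
  rw [← mem_restrictTotalDegree, ← p.support_sum_monomial_coeff, map_sum]
  refine Submodule.sum_mem _ fun d hd => ?_
  have hd1 := degree_le_of_mem hp hd
  rw [pderiv_monomial, mem_restrictTotalDegree]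
  by_cases hk : d k = 0
  · simp [hk]
  · refine (totalDegree_monomial_le _ _).trans ?_
    have hle : Finsupp.single k 1 ≤ d := by
      rw [Finsupp.single_le_iff]; exact Nat.one_le_iff_ne_zero.2 hk
    have h2 : d.degree = (Finsupp.single k 1 + (d - Finsupp.single k 1)).degree := by
      rw [add_tsub_cancel_of_le hle]
    rw [map_add, Finsupp.degree_single] at h2
    change (d - Finsupp.single k 1).degree ≤ n
    omega

theorem hasDerivAt_eval (γ : ℝ → Fin 3 → ℝ) (γ' : Fin 3 → ℝ) (u : ℝ)
    (h : ∀ k, HasDerivAt (fun u => γ u k) (γ' k) u) (p : MvPolynomial (Fin 3) ℝ) :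
    HasDerivAt (fun u => eval (γ u) p) (∑ k, γ' k * eval (γ u) (pderiv k p)) u := by
  induction p using MvPolynomial.induction_on with
  | C c => simpa using hasDerivAt_const u c
  | add p q hp hq =>
    simp only [map_add, mul_add, Finset.sum_add_distrib]
    exact hp.add hq
  | mul_X p i hp =>
    have := hp.mul (h i)
    simp only [map_mul, eval_X]
    refine this.congr_deriv ?_
    simp only [Derivation.leibniz, pderiv_X, smul_eq_mul, map_add, map_mul, eval_X, mul_add,
      Finset.sum_add_distrib]
    rw [add_comm]
    congr 1
    · rw [Finset.sum_eq_single i]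
      · simp; ring
      · intro b _ hb; simp [Ne.symm hb]
      · simp
    · rw [Finset.sum_mul]; exact Finset.sum_congr rfl fun k _ => by ring

theorem continuous_evalP (p : MvPolynomial (Fin 3) ℝ) : Continuous fun x : E3 => evalP x p := by
  unfold evalP
  exact (MvPolynomial.continuous_eval p).comp (by fun_prop)

theorem continuous_psi {n : ℕ} (p : Fin (n + 1) → E3) : Continuous (psi p) := by
  unfold psi; fun_prop

theorem continuous_ep {n : ℕ} (p : Fin (n + 1) → E3) (q : MvPolynomial (Fin 3) ℝ) :
    Continuous fun t => evalP (psi p t) q :=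
  (continuous_evalP q).comp (continuous_psi p)

theorem integrable_tri {n : ℕ} {f : (Fin n → ℝ) → ℝ} (hf : Continuous f) :
    IntegrableOn f (Tri n) :=
  hf.continuousOn.integrableOn_compact (isCompact_Tri n)

/-! ### Geometry -/

theorem face_eq (a : Fin 4 → E3) (i : Fin 4) :
    face a i = convexHull ℝ (Set.range (a ∘ i.succAbove)) := by
  rw [face, Set.range_comp, Fin.range_succAbove]; rfl

theorem face_zero_eq (a : Fin 4 → E3) (j : Fin 3) :
    face a 0 = convexHull ℝ (Set.range
      (Fin.cons (a j.succ) (fun i => a (j.succAbove i).succ) : Fin 3 → E3)) := by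
  rw [face]
  congr 1
  ext x
  simp only [Set.mem_image, Set.mem_range]
  constructor
  · rintro ⟨i, hi, rfl⟩
    obtain ⟨i, rfl⟩ := Fin.exists_succ_eq.2 hi
    rcases Fin.eq_self_or_eq_succAbove j i with rfl | ⟨i, rfl⟩
    · exact ⟨0, rfl⟩
    · exact ⟨i.succ, rfl⟩
  · rintro ⟨i, rfl⟩
    refine Fin.cases ?_ (fun i => ?_) i
    · exact ⟨j.succ, Fin.succ_ne_zero _, rfl⟩
    · exact ⟨_, Fin.succ_ne_zero _, rfl⟩

theorem psi_succAbove (a : Fin 4 → E3) (j : Fin 3) (s : Fin 2 → ℝ) :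
    psi (a ∘ j.succ.succAbove) s = psi a (j.insertNth 0 s) := by
  simp [psi, Fin.sum_univ_succAbove _ j]

theorem psi_cons (a : Fin 4 → E3) (j : Fin 3) (s : Fin 2 → ℝ) :
    psi (Fin.cons (a j.succ) (fun i => a (j.succAbove i).succ) : Fin 3 → E3) s
      = psi a (j.insertNth (1 - ∑ i, s i) s) := by
  simp only [psi, Fin.sum_univ_succAbove _ j, Fin.insertNth_apply_same,
    Fin.insertNth_apply_succAbove, Fin.cons_zero, Fin.cons_succ, Fin.sum_univ_two]
  module

/-- Integrals over the face opposite to vertex `j+1`. -/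
theorem face_int (a : Fin 4 → E3) (hind : AffineIndependent ℝ a) (i : Fin 4) :
    ∃ c : ℝ, c ≠ 0 ∧ ∀ f : E3 → ℝ, ∫ x in face a i, f x ∂(μH[2])
      = c * ∫ s in Tri 2, f (psi (a ∘ i.succAbove) s) := by
  have := face_integral (n := 2) (a ∘ i.succAbove)
    (hind.comp_embedding i.succAboveEmb)
  rw [face_eq]
  simpa using this

theorem face_zero_int (a : Fin 4 → E3) (hind : AffineIndependent ℝ a) (j : Fin 3) :
    ∃ c : ℝ, c ≠ 0 ∧ ∀ f : E3 → ℝ, ∫ x in face a 0, f x ∂(μH[2])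
      = c * ∫ s in Tri 2, f (psi a (j.insertNth (1 - ∑ i, s i) s)) := by
  have hinj : Function.Injective
      (Fin.cons j.succ (fun i => (j.succAbove i).succ) : Fin 3 → Fin 4) := by
    rw [Fin.cons_injective_iff]
    refine ⟨?_, ?_⟩
    · rintro ⟨i, hi⟩
      exact Fin.succAbove_ne j i (Fin.succ_injective _ hi)
    · exact (Fin.succ_injective _).comp Fin.succAbove_right_injective
  have := face_integral (n := 2) _ (hind.comp_embedding ⟨_, hinj⟩)
  have h2 : a ∘ (Fin.cons j.succ (fun i => (j.succAbove i).succ) : Fin 3 → Fin 4)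
    = (Fin.cons (a j.succ) (fun i => a (j.succAbove i).succ) : Fin 3 → E3) := by
    ext1 i
    refine Fin.cases ?_ (fun i => ?_) i <;> simp
  rw [Function.Embedding.coeFn_mk, h2] at this
  rw [face_zero_eq a j]
  simp_rw [psi_cons] at this
  simpa using this

theorem tetra_int (a : Fin 4 → E3) (hind : AffineIndependent ℝ a) :
    ∃ c : ℝ, c ≠ 0 ∧ ∀ f : E3 → ℝ, ∫ x in tetra a, f x = c * ∫ s in Tri 3, f (psi a s) := by
  obtain ⟨c, hc, h⟩ := face_integral (n := 3) a hind
  set μ : Measure E3 := μH[((3 : ℕ) : ℝ)]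
  have hv : (volume : Measure E3) = _ • μ := Measure.isAddLeftInvariant_eq_smul volume μ
  set κ := (volume : Measure E3).addHaarScalarFactor μ
  refine ⟨κ * c, mul_ne_zero ?_ hc, fun f => ?_⟩
  · intro h0
    rw [NNReal.coe_eq_zero] at h0
    rw [h0, zero_smul] at hv
    have h2 := isOpen_univ.measure_ne_zero (volume : Measure E3) Set.univ_nonempty
    rw [hv] at h2
    simp at h2
  · rw [tetra, hv, Measure.restrict_smul, integral_smul_nnreal_measure, h, mul_assoc]
    rfl

/-- Edge matrix. -/
def Em (a : Fin 4 → E3) : Matrix (Fin 3) (Fin 3) ℝ := fun j k => a j.succ k - a 0 k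

theorem Em_det (a : Fin 4 → E3) (hind : AffineIndependent ℝ a) : IsUnit (Em a) := by
  rw [← Matrix.linearIndependent_rows_iff_isUnit]
  have h := (affineIndependent_iff_linearIndependent_vsub ℝ a 0).1 hind
  have h2 := h.comp (fun j : Fin 3 => (⟨j.succ, Fin.succ_ne_zero j⟩ : {x : Fin 4 // x ≠ 0}))
    (fun i j hij => by simpa using hij)
  have h3 := h2.map' (WithLp.linearEquiv 2 ℝ (Fin 3 → ℝ)).toLinearMap (LinearEquiv.ker _)
  exact h3

theorem psi_apply (a : Fin 4 → E3) (t : Fin 3 → ℝ) (k : Fin 3) :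
    psi a t k = a 0 k + ∑ j, t j * Em a j k := by
  simp [psi, Em]

/-! ### Bubbles -/

/-- The cubic bubble space. -/
def Bub (a : Fin 4 → E3) (hind : AffineIndependent ℝ a) :
    Submodule ℝ (MvPolynomial (Fin 3) ℝ) where
  carrier := {v | v.totalDegree ≤ 3 ∧
    ∀ (i : Fin 4) (q : MvPolynomial (Fin 3) ℝ), q.totalDegree ≤ 1 →
      ∫ x in face a i, evalP x v * evalP x q ∂(μH[2]) = 0}
  zero_mem' := ⟨by simp, fun i q _ => by simp [evalP]⟩
  add_mem' := by
    rintro v w ⟨hv, hv'⟩ ⟨hw, hw'⟩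
    refine ⟨td_add hv hw, fun i q hq => ?_⟩
    obtain ⟨c, hc, h⟩ := face_int a hind i
    have h1 := hv' i q hq
    have h2 := hw' i q hq
    rw [h] at h1 h2 ⊢
    have : ∀ x : E3, evalP x (v + w) * evalP x q = evalP x v * evalP x q + evalP x w * evalP x q := by
      intro x; simp [evalP, add_mul]
    simp_rw [this]
    rw [integral_add, mul_add, h1, h2, add_zero]
    · exact integrable_tri ((continuous_ep _ v).mul (continuous_ep _ q))
    · exact integrable_tri ((continuous_ep _ w).mul (continuous_ep _ q))
  smul_mem' := by
    rintro r v ⟨hv, hv'⟩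
    refine ⟨(totalDegree_smul_le r v).trans hv, fun i q hq => ?_⟩
    have : ∀ x : E3, evalP x (r • v) * evalP x q = r * (evalP x v * evalP x q) := by
      intro x; simp [evalP, mul_assoc]
    simp_rw [this]
    rw [integral_const_mul, hv' i q hq, mul_zero]

theorem bub_one {a : Fin 4 → E3} {hind : AffineIndependent ℝ a} {v : MvPolynomial (Fin 3) ℝ}
    (hv : v ∈ Bub a hind) (i : Fin 4) : ∫ x in face a i, evalP x v ∂(μH[2]) = 0 := by
  have := hv.2 i 1 (by simp)
  simpa [evalP] using this

/-- The flux through the boundary of a bubble vanishes. -/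
theorem ftc_zero {a : Fin 4 → E3} {hind : AffineIndependent ℝ a} {v : MvPolynomial (Fin 3) ℝ}
    (hv : v ∈ Bub a hind) (j : Fin 3) :
    ∫ t in Tri 3, ∑ k, Em a j k * evalP (psi a t) (pderiv k v) = 0 := by
  have hc : Continuous fun t => ∑ k, Em a j k * evalP (psi a t) (pderiv k v) :=
    continuous_finsetSum _ fun k _ => continuous_const.mul (continuous_ep a _)
  have hins : ∀ s : Fin 2 → ℝ, Continuous fun u : ℝ => (j.insertNth u s : Fin 3 → ℝ) := by
    intro s
    exact Continuous.finInsertNth j continuous_id continuous_const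
  rw [slice j _ hc]
  have h1 : ∀ s : Fin 2 → ℝ, (∫ u in (0 : ℝ)..(1 - ∑ i, s i),
      ∑ k, Em a j k * evalP (psi a (j.insertNth u s)) (pderiv k v))
      = evalP (psi a (j.insertNth (1 - ∑ i, s i) s)) v - evalP (psi a (j.insertNth 0 s)) v := by
    intro s
    refine intervalIntegral.integral_eq_sub_of_hasDerivAt
      (f := fun u => evalP (psi a (j.insertNth u s)) v) (fun u _ => ?_) ?_
    · refine hasDerivAt_eval (fun u k => psi a (j.insertNth u s) k) (fun k => Em a j k) u
        (fun k => ?_) v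
      simp only [psi_apply, Fin.sum_univ_succAbove _ j, Fin.insertNth_apply_same,
        Fin.insertNth_apply_succAbove]
      have := ((((hasDerivAt_id u).mul_const (Em a j k)).add_const
        (∑ i, s i * Em a (j.succAbove i) k)).const_add (a 0 k))
      simpa using this
    · exact (hc.comp (hins s)).intervalIntegrable _ _
  simp_rw [h1]
  have hi1 : Continuous fun s : Fin 2 → ℝ => (j.insertNth (1 - ∑ i, s i) s : Fin 3 → ℝ) :=
    Continuous.finInsertNth j (by fun_prop) continuous_id
  have hi2 : Continuous fun s : Fin 2 → ℝ => (j.insertNth 0 s : Fin 3 → ℝ) :=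
    Continuous.finInsertNth j continuous_const continuous_id
  refine (integral_sub (integrable_tri ((continuous_ep a v).comp hi1))
    (integrable_tri ((continuous_ep a v).comp hi2))).trans ?_
  simp only [Function.comp_apply]
  obtain ⟨c, hc0, h⟩ := face_zero_int a hind j
  obtain ⟨c', hc0', h'⟩ := face_int a hind j.succ
  have e1 := bub_one hv 0
  have e2 := bub_one hv j.succ
  rw [h] at e1
  rw [h'] at e2
  simp_rw [psi_succAbove] at e2
  rw [(mul_eq_zero.1 e1).resolve_left hc0, (mul_eq_zero.1 e2).resolve_left hc0', sub_zero]

theorem pderiv_int_zero {a : Fin 4 → E3} {hind : AffineIndependent ℝ a}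
    {v : MvPolynomial (Fin 3) ℝ} (hv : v ∈ Bub a hind) (k : Fin 3) :
    ∫ t in Tri 3, evalP (psi a t) (pderiv k v) = 0 := by
  have hdet : (Em a).det ≠ 0 := by
    have := Em_det a hind
    rw [Matrix.isUnit_iff_isUnit_det] at this
    exact this.ne_zero
  have := Matrix.eq_zero_of_mulVec_eq_zero (M := Em a)
    (v := fun k => ∫ t in Tri 3, evalP (psi a t) (pderiv k v)) hdet ?_
  · exact congrFun this k
  · ext j
    have h := ftc_zero hv j
    rw [integral_finsetSum] at h
    · simp_rw [integral_const_mul] at h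
      exact h
    · intro k _
      exact integrable_tri (continuous_const.mul (continuous_ep a _))

theorem div_int_zero {a : Fin 4 → E3} {hind : AffineIndependent ℝ a}
    {v : Fin 3 → MvPolynomial (Fin 3) ℝ} (hv : ∀ k, v k ∈ Bub a hind) :
    ∫ x in tetra a, evalP x (∑ k, pderiv k (v k)) = 0 := by
  obtain ⟨c, -, h⟩ := tetra_int a hind
  rw [h]
  have : ∀ x : E3, evalP x (∑ k, pderiv k (v k)) = ∑ k, evalP x (pderiv k (v k)) := by
    intro x; simp [evalP]
  simp_rw [this]
  rw [integral_finsetSum]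
  · simp [fun k => pderiv_int_zero (hv k) k]
  · intro k _
    exact integrable_tri (continuous_ep a _)

theorem deg_one_psi {p : Fin 3 → E3} {q : MvPolynomial (Fin 3) ℝ} (hq : q.totalDegree ≤ 1) :
    ∃ α β γ : ℝ, ∀ s, evalP (psi p s) q = α + β * s 0 + γ * s 1 := by
  let S : Submodule ℝ (MvPolynomial (Fin 3) ℝ) :=
    { carrier := {q | ∃ α β γ : ℝ, ∀ s, evalP (psi p s) q = α + β * s 0 + γ * s 1}
      zero_mem' := ⟨0, 0, 0, fun s => by simp [evalP]⟩
      add_mem' := by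
        rintro q r ⟨α, β, γ, h⟩ ⟨α', β', γ', h'⟩
        refine ⟨α + α', β + β', γ + γ', fun s => ?_⟩
        have : evalP (psi p s) (q + r) = evalP (psi p s) q + evalP (psi p s) r := by simp [evalP]
        rw [this, h, h']; ring
      smul_mem' := by
        rintro c q ⟨α, β, γ, h⟩
        refine ⟨c * α, c * β, c * γ, fun s => ?_⟩
        have : evalP (psi p s) (c • q) = c * evalP (psi p s) q := by simp [evalP]
        rw [this, h]; ring }
  refine mem_deg_one S ⟨1, 0, 0, fun s => by simp [evalP]⟩ (fun k => ?_) hq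
  refine ⟨p 0 k, p 1 k - p 0 k, p 2 k - p 0 k, fun s => ?_⟩
  simp [evalP, psi, Fin.sum_univ_two]
  ring

theorem bubble_mem {a : Fin 4 → E3} (hind : AffineIndependent ℝ a) {b : MvPolynomial (Fin 3) ℝ}
    (hb : b.totalDegree ≤ 3) (F : ℝ → ℝ → ℝ → ℝ)
    (hF : ∀ t, evalP (psi a t) b = F (t 0) (t 1) (t 2))
    (h0 : ∀ α β γ, ∫ s in Tri 2, F (1 - s 0 - s 1) (s 0) (s 1) * (α + β * s 0 + γ * s 1) = 0)
    (h1 : ∀ α β γ, ∫ s in Tri 2, F 0 (s 0) (s 1) * (α + β * s 0 + γ * s 1) = 0)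
    (h2 : ∀ α β γ, ∫ s in Tri 2, F (s 0) 0 (s 1) * (α + β * s 0 + γ * s 1) = 0)
    (h3 : ∀ α β γ, ∫ s in Tri 2, F (s 0) (s 1) 0 * (α + β * s 0 + γ * s 1) = 0) :
    b ∈ Bub a hind := by
  refine ⟨hb, fun i q hq => ?_⟩
  obtain ⟨c, -, h⟩ := face_int a hind i
  rw [h]
  obtain ⟨α, β, γ, hq'⟩ := deg_one_psi (p := a ∘ i.succAbove) hq
  simp_rw [hq']
  refine mul_eq_zero_of_right _ ?_
  have key : ∀ T : (Fin 2 → ℝ) → Fin 3 → ℝ, (∀ s, psi (a ∘ i.succAbove) s = psi a (T s)) →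
      (∫ s in Tri 2, F (T s 0) (T s 1) (T s 2) * (α + β * s 0 + γ * s 1)) = 0 →
      ∫ s in Tri 2, evalP (psi (a ∘ i.succAbove) s) b * (α + β * s 0 + γ * s 1) = 0 := by
    intro T hT h
    rw [← h]
    simp_rw [hT, hF]
  fin_cases i
  · refine key (fun s => ![1 - s 0 - s 1, s 0, s 1]) (fun s => ?_) (h0 α β γ)
    have e1 : (0 : Fin 4).succAbove (0 : Fin 3) = 1 := rfl
    have e2 : (0 : Fin 4).succAbove (1 : Fin 3) = 2 := rfl
    have e3 : (0 : Fin 4).succAbove (2 : Fin 3) = 3 := rfl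
    have e4 : (2 : Fin 3).succ = (3 : Fin 4) := rfl
    simp [psi, Fin.sum_univ_three, e1, e2, e3, e4]
    module
  · refine key (fun s => ![0, s 0, s 1]) (fun s => ?_) (h1 α β γ)
    have e1 : (1 : Fin 4).succAbove (0 : Fin 3) = 0 := rfl
    have e2 : (1 : Fin 4).succAbove (1 : Fin 3) = 2 := rfl
    have e3 : (1 : Fin 4).succAbove (2 : Fin 3) = 3 := rfl
    have e4 : (2 : Fin 3).succ = (3 : Fin 4) := rfl
    simp [psi, Fin.sum_univ_three, e1, e2, e3, e4]
  · refine key (fun s => ![s 0, 0, s 1]) (fun s => ?_) (h2 α β γ)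
    have e1 : (2 : Fin 4).succAbove (0 : Fin 3) = 0 := rfl
    have e2 : (2 : Fin 4).succAbove (1 : Fin 3) = 1 := rfl
    have e3 : (2 : Fin 4).succAbove (2 : Fin 3) = 3 := rfl
    have e4 : (2 : Fin 3).succ = (3 : Fin 4) := rfl
    simp [psi, Fin.sum_univ_three, e1, e2, e3, e4]
  · refine key (fun s => ![s 0, s 1, 0]) (fun s => ?_) (h3 α β γ)
    have e1 : (3 : Fin 4).succAbove (0 : Fin 3) = 0 := rfl
    have e2 : (3 : Fin 4).succAbove (1 : Fin 3) = 1 := rfl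
    have e3 : (3 : Fin 4).succAbove (2 : Fin 3) = 2 := rfl
    have e4 : (2 : Fin 3).succ = (3 : Fin 4) := rfl
    simp [psi, Fin.sum_univ_three, e1, e2, e3, e4]

/-- Barycentric coordinates as polynomials. -/
def tau (a : Fin 4 → E3) (j : Fin 3) : MvPolynomial (Fin 3) ℝ :=
  ∑ k, C ((Em a)⁻¹ k j) * (X k - C (a 0 k))

theorem td_tau (a : Fin 4 → E3) (j : Fin 3) : (tau a j).totalDegree ≤ 1 := by
  refine totalDegree_finsetSum_le fun k _ => td_C_mul _ (td_sub (by simp) (by simp))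

theorem Em_mul {a : Fin 4 → E3} (hind : AffineIndependent ℝ a) : Em a * (Em a)⁻¹ = 1 :=
  Matrix.mul_nonsing_inv _ ((Matrix.isUnit_iff_isUnit_det _).1 (Em_det a hind))

theorem mul_Em {a : Fin 4 → E3} (hind : AffineIndependent ℝ a) : (Em a)⁻¹ * Em a = 1 :=
  Matrix.nonsing_inv_mul _ ((Matrix.isUnit_iff_isUnit_det _).1 (Em_det a hind))

theorem eval_tau {a : Fin 4 → E3} (hind : AffineIndependent ℝ a) (j : Fin 3) (t : Fin 3 → ℝ) :
    eval (fun k => psi a t k) (tau a j) = t j := by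
  have h : Matrix.vecMul (Matrix.vecMul t (Em a)) (Em a)⁻¹ = t := by
    rw [Matrix.vecMul_vecMul, Em_mul hind, Matrix.vecMul_one]
  conv_rhs => rw [← h]
  simp [tau, psi_apply, Matrix.vecMul, dotProduct, mul_comm]

theorem X_eq {a : Fin 4 → E3} (hind : AffineIndependent ℝ a) (k : Fin 3) :
    (X k : MvPolynomial (Fin 3) ℝ) = C (a 0 k) + ∑ j, C (Em a j k) * tau a j := by
  have h : ∀ l, ∑ j, Em a j k * (Em a)⁻¹ l j = if l = k then 1 else 0 := by
    intro l
    have := congrFun (congrFun (mul_Em hind) l) k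
    rw [Matrix.mul_apply, Matrix.one_apply] at this
    rw [← this]
    exact Finset.sum_congr rfl fun _ _ => mul_comm _ _
  have h2 : ∑ j, C (Em a j k) * tau a j = X k - C (a 0 k) := by
    simp only [tau, Finset.mul_sum]
    rw [Finset.sum_comm]
    simp only [← mul_assoc, ← C_mul, ← Finset.sum_mul, ← map_sum, h]
    simp
  rw [h2]; ring

/-- Derivative in the direction of an edge. -/
def dirD (a : Fin 4 → E3) (j : Fin 3) :
    Derivation ℝ (MvPolynomial (Fin 3) ℝ) (MvPolynomial (Fin 3) ℝ) :=
  ∑ k, Em a j k • pderiv k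

theorem dirD_apply (a : Fin 4 → E3) (j : Fin 3) (p : MvPolynomial (Fin 3) ℝ) :
    dirD a j p = ∑ k, Em a j k • pderiv k p := by
  simp [dirD, Fin.sum_univ_three]

theorem dirD_tau {a : Fin 4 → E3} (hind : AffineIndependent ℝ a) (i j : Fin 3) :
    dirD a j (tau a i) = if j = i then 1 else 0 := by
  have := congrFun (congrFun (Em_mul hind) j) i
  rw [Matrix.mul_apply, Matrix.one_apply] at this
  have h : ∀ k, pderiv k (tau a i) = C ((Em a)⁻¹ k i) := by
    intro k
    simp [tau, Derivation.leibniz, pderiv_X, Pi.single_apply]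
  rw [dirD_apply]
  simp only [h, smul_eq_C_mul, ← C_mul, ← map_sum, this]
  split_ifs <;> simp

theorem mem_A {a : Fin 4 → E3} (hind : AffineIndependent ℝ a) :
    1 - 4 * (tau a 0 * tau a 1 + tau a 1 * tau a 2 + tau a 2 * tau a 0
      + (tau a 0 + tau a 1 + tau a 2) * (1 - tau a 0 - tau a 1 - tau a 2)) ∈ Bub a hind := by
  have hx := td_tau a 0
  have hy := td_tau a 1
  have hz := td_tau a 2
  have h1 : (1 : MvPolynomial (Fin 3) ℝ).totalDegree ≤ 1 := by simp
  have h4 : (4 : MvPolynomial (Fin 3) ℝ).totalDegree ≤ 0 := (totalDegree_C (4 : ℝ)).le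
  refine bubble_mem hind ?_
    (fun x y z => 1 - 4 * (x * y + y * z + z * x + (x + y + z) * (1 - x - y - z))) ?_ ?_ ?_ ?_ ?_
  · refine td_sub (by simp) ((td_mul h4 (td_add (td_add (td_add (td_mul hx hy) (td_mul hy hz))
      (td_mul hz hx)) (td_mul (td_add (td_add hx hy) hz)
        (td_sub (td_sub (td_sub h1 hx) hy) hz)))).trans (by norm_num))
  · intro t
    simp [evalP, eval_tau hind]
  all_goals
    intro α β γ
    refine (integral_congr_ae (Filter.Eventually.of_forall fun s => ?_)).trans (mom_symA α β γ)
    ring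

theorem mem_b {a : Fin 4 → E3} (hind : AffineIndependent ℝ a) :
    1 - 4 * (tau a 0 + tau a 1 + tau a 2)
      + 20 * (tau a 0 * tau a 1 + tau a 1 * tau a 2 + tau a 2 * tau a 0)
      - 120 * (tau a 0 * tau a 1 * tau a 2) ∈ Bub a hind := by
  have hx := td_tau a 0
  have hy := td_tau a 1
  have hz := td_tau a 2
  have h4 : (4 : MvPolynomial (Fin 3) ℝ).totalDegree ≤ 2 :=
    (totalDegree_C (4 : ℝ)).le.trans (by norm_num)
  have h20 : (20 : MvPolynomial (Fin 3) ℝ).totalDegree ≤ 1 :=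
    (totalDegree_C (20 : ℝ)).le.trans (by norm_num)
  have h120 : (120 : MvPolynomial (Fin 3) ℝ).totalDegree ≤ 0 := (totalDegree_C (120 : ℝ)).le
  refine bubble_mem hind ?_
    (fun x y z => 1 - 4 * (x + y + z) + 20 * (x * y + y * z + z * x) - 120 * (x * y * z))
    ?_ ?_ ?_ ?_ ?_
  · refine td_sub (td_add (td_sub (by simp) (td_mul h4 (td_add (td_add hx hy) hz)))
      (td_mul h20 (td_add (td_add (td_mul hx hy) (td_mul hy hz)) (td_mul hz hx))))
      ((td_mul h120 (td_mul (td_mul hx hy) hz)).trans (by norm_num))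
  · intro t
    simp [evalP, eval_tau hind]
  · intro α β γ
    refine (integral_congr_ae (Filter.Eventually.of_forall fun s => ?_)).trans
      (mom_b0_opp (20 * α) (20 * β) (20 * γ))
    ring
  all_goals
    intro α β γ
    refine (integral_congr_ae (Filter.Eventually.of_forall fun s => ?_)).trans
      (mom_b0_side (20 * α) (20 * β) (20 * γ))
    ring

theorem mem_G {a : Fin 4 → E3} (hind : AffineIndependent ℝ a) (j : Fin 3) :
    5 * (tau a j * tau a j * tau a j) - 5 * (tau a j * tau a j) + tau a j ∈ Bub a hind := by
  have hx := td_tau a j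
  have h5 : (5 : MvPolynomial (Fin 3) ℝ).totalDegree ≤ 0 := (totalDegree_C (5 : ℝ)).le
  have hd : (5 * (tau a j * tau a j * tau a j) - 5 * (tau a j * tau a j) + tau a j).totalDegree
      ≤ 3 := by
    refine td_add (td_sub ((td_mul h5 (td_mul (td_mul hx hx) hx)).trans (by norm_num))
      ((td_mul h5 (td_mul hx hx)).trans (by norm_num))) (hx.trans (by norm_num))
  have hev : ∀ t, evalP (psi a t)
      (5 * (tau a j * tau a j * tau a j) - 5 * (tau a j * tau a j) + tau a j)
      = 5 * (t j) ^ 3 - 5 * (t j) ^ 2 + t j := by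
    intro t
    simp [evalP, eval_tau hind]
    ring
  have close : ∀ (f g : (Fin 2 → ℝ) → ℝ), (∀ s, f s = g s) → ∫ s in Tri 2, g s = 0 →
      ∫ s in Tri 2, f s = 0 := by
    intro f g h h0
    rw [show f = g from funext h, h0]
  have hz : ∫ s in Tri 2, (fun _ => (0 : ℝ)) s = 0 := by simp
  fin_cases j
  · refine bubble_mem hind hd (fun x y z => 5 * x ^ 3 - 5 * x ^ 2 + x) hev
      (fun α β γ => mom_G_sum α β γ) (fun α β γ => ?_) (fun α β γ => mom_G_zero α β γ)
      (fun α β γ => mom_G_zero α β γ)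
    exact close _ _ (fun s => by ring) hz
  · refine bubble_mem hind hd (fun x y z => 5 * y ^ 3 - 5 * y ^ 2 + y) hev
      (fun α β γ => mom_G_zero α β γ) (fun α β γ => mom_G_zero α β γ) (fun α β γ => ?_)
      (fun α β γ => mom_G_one α β γ)
    exact close _ _ (fun s => by ring) hz
  · refine bubble_mem hind hd (fun x y z => 5 * z ^ 3 - 5 * z ^ 2 + z) hev
      (fun α β γ => mom_G_one α β γ) (fun α β γ => mom_G_one α β γ)
      (fun α β γ => mom_G_one α β γ) (fun α β γ => ?_)
    exact close _ _ (fun s => by ring) hz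

/-- The divergence as a linear map. -/
def divL : (Fin 3 → MvPolynomial (Fin 3) ℝ) →ₗ[ℝ] MvPolynomial (Fin 3) ℝ :=
  ∑ k, (pderiv k).toLinearMap ∘ₗ LinearMap.proj k

theorem divL_apply (v : Fin 3 → MvPolynomial (Fin 3) ℝ) : divL v = ∑ k, pderiv k (v k) := by
  simp [divL]

/-- Divergences of bubbles. -/
def DivB (a : Fin 4 → E3) (hind : AffineIndependent ℝ a) : Submodule ℝ (MvPolynomial (Fin 3) ℝ) :=
  (Submodule.pi Set.univ fun _ => Bub a hind).map divL

theorem dirD_mem {a : Fin 4 → E3} {hind : AffineIndependent ℝ a} {b : MvPolynomial (Fin 3) ℝ}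
    (hb : b ∈ Bub a hind) (j : Fin 3) : dirD a j b ∈ DivB a hind := by
  refine ⟨fun k => Em a j k • b, fun k _ => Submodule.smul_mem _ _ hb, ?_⟩
  rw [divL_apply, dirD_apply]
  simp

theorem cancel_nat (S : Submodule ℝ (MvPolynomial (Fin 3) ℝ)) {p : MvPolynomial (Fin 3) ℝ} (n : ℕ)
    (hn : n ≠ 0) (h : (n : MvPolynomial (Fin 3) ℝ) * p ∈ S) : p ∈ S := by
  rw [← nsmul_eq_mul, ← Nat.cast_smul_eq_nsmul ℝ] at h
  exact (S.smul_mem_iff (by exact_mod_cast hn)).1 h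

theorem span_all {a : Fin 4 → E3} (hind : AffineIndependent ℝ a) {p : MvPolynomial (Fin 3) ℝ}
    (hp : p.totalDegree ≤ 2) : p ∈ DivB a hind ⊔ Submodule.span ℝ {1} := by
  set S := DivB a hind ⊔ Submodule.span ℝ {(1 : MvPolynomial (Fin 3) ℝ)} with hS
  have hmem : ∀ {b}, b ∈ Bub a hind → ∀ j, dirD a j b ∈ S := fun hb j =>
    Submodule.mem_sup_left (dirD_mem hb j)
  have h1 : (1 : MvPolynomial (Fin 3) ℝ) ∈ S :=
    Submodule.mem_sup_right (Submodule.mem_span_singleton_self 1)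
  have hnm : ∀ (n : ℕ) {q}, q ∈ S → (n : MvPolynomial (Fin 3) ℝ) * q ∈ S := fun n q hq => by
    rw [← nsmul_eq_mul]; exact S.nsmul_mem hq n
  have hC : ∀ (c : ℝ) {q}, q ∈ S → C c * q ∈ S := fun c q hq => by
    rw [← smul_eq_C_mul]; exact S.smul_mem _ hq
  have hnum : ∀ (j : Fin 3) (n : ℕ) [n.AtLeastTwo], dirD a j (OfNat.ofNat n) = 0 := by
    intro j n _
    exact (dirD a j).map_natCast n
  have d00 : dirD a 0 (tau a 0) = 1 := by simp [dirD_tau hind]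
  have d01 : dirD a 0 (tau a 1) = 0 := by simp [dirD_tau hind]
  have d02 : dirD a 0 (tau a 2) = 0 := by simp [dirD_tau hind]
  have d10 : dirD a 1 (tau a 0) = 0 := by simp [dirD_tau hind]
  have d11 : dirD a 1 (tau a 1) = 1 := by simp [dirD_tau hind]
  have d12 : dirD a 1 (tau a 2) = 0 := by simp [dirD_tau hind]
  have d20 : dirD a 2 (tau a 0) = 0 := by simp [dirD_tau hind]
  have d21 : dirD a 2 (tau a 1) = 0 := by simp [dirD_tau hind]
  have d22 : dirD a 2 (tau a 2) = 1 := by simp [dirD_tau hind]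
  have A0 := hmem (mem_A hind) 0
  have A1 := hmem (mem_A hind) 1
  have A2 := hmem (mem_A hind) 2
  have b0 := hmem (mem_b hind) 0
  have b1 := hmem (mem_b hind) 1
  have b2 := hmem (mem_b hind) 2
  have hG := fun j => hmem (mem_G hind j) j
  have hsq : ∀ j, tau a j ∈ S → tau a j * tau a j ∈ S := by
    intro j hj
    have hjj : dirD a j (tau a j) = 1 := by simp [dirD_tau hind]
    refine cancel_nat S 15 (by norm_num) ?_
    have h := S.sub_mem (S.add_mem (hG j) (hnm 10 hj)) h1
    convert h using 1
    simp only [map_add, map_sub, Derivation.leibniz, smul_eq_mul, hjj, hnum]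
    push_cast
    ring
  simp only [map_add, map_sub, Derivation.leibniz, smul_eq_mul, hnum, d00, d01, d02, d10, d11,
    d12, d20, d21, d22, Derivation.map_one_eq_zero] at A0 A1 A2 b0 b1 b2
  have hx : tau a 0 ∈ S := by
    refine cancel_nat S 16 (by norm_num) ?_
    have h := S.sub_mem (S.add_mem (hnm 4 h1) (hnm 4 A0)) (S.add_mem (S.add_mem A0 A1) A2)
    convert h using 1
    push_cast; ring
  have hy : tau a 1 ∈ S := by
    refine cancel_nat S 16 (by norm_num) ?_
    have h := S.sub_mem (S.add_mem (hnm 4 h1) (hnm 4 A1)) (S.add_mem (S.add_mem A0 A1) A2)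
    convert h using 1
    push_cast; ring
  have hz : tau a 2 ∈ S := by
    refine cancel_nat S 16 (by norm_num) ?_
    have h := S.sub_mem (S.add_mem (hnm 4 h1) (hnm 4 A2)) (S.add_mem (S.add_mem A0 A1) A2)
    convert h using 1
    push_cast; ring
  have hyz : tau a 1 * tau a 2 ∈ S := by
    refine cancel_nat S 120 (by norm_num) ?_
    have h := S.sub_mem (S.sub_mem (hnm 20 (S.add_mem hy hz)) b0) (hnm 4 h1)
    convert h using 1
    push_cast; ring
  have hxz : tau a 0 * tau a 2 ∈ S := by
    refine cancel_nat S 120 (by norm_num) ?_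
    have h := S.sub_mem (S.sub_mem (hnm 20 (S.add_mem hx hz)) b1) (hnm 4 h1)
    convert h using 1
    push_cast; ring
  have hxy : tau a 0 * tau a 1 ∈ S := by
    refine cancel_nat S 120 (by norm_num) ?_
    have h := S.sub_mem (S.sub_mem (hnm 20 (S.add_mem hx hy)) b2) (hnm 4 h1)
    convert h using 1
    push_cast; ring
  have hτ : ∀ j, tau a j ∈ S := by
    intro j; fin_cases j
    · exact hx
    · exact hy
    · exact hz
  have hττ : ∀ i j, tau a i * tau a j ∈ S := by
    intro i j
    fin_cases i <;> fin_cases j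
    · exact hsq 0 hx
    · exact hxy
    · exact hxz
    · exact (mul_comm (tau a 0) (tau a 1)) ▸ hxy
    · exact hsq 1 hy
    · exact hyz
    · exact (mul_comm (tau a 0) (tau a 2)) ▸ hxz
    · exact (mul_comm (tau a 1) (tau a 2)) ▸ hyz
    · exact hsq 2 hz
  have hCS : ∀ c : ℝ, C c ∈ S := fun c => by simpa using hC c h1
  have hX : ∀ k, X k ∈ S := by
    intro k
    rw [X_eq hind k]
    exact S.add_mem (hCS _) (S.sum_mem fun j _ => hC _ (hτ j))
  refine mem_deg_two S h1 hX (fun k l => ?_) hp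
  have hτX : ∀ j, tau a j * X l ∈ S := by
    intro j
    rw [X_eq hind l, mul_add, Finset.mul_sum]
    refine S.add_mem ?_ (S.sum_mem fun i _ => ?_)
    · rw [mul_comm]; exact hC _ (hτ j)
    · rw [mul_left_comm]; exact hC _ (hττ j i)
  rw [X_eq hind k, add_mul, Finset.sum_mul]
  refine S.add_mem (hC _ (hX l)) (S.sum_mem fun j _ => ?_)
  rw [mul_assoc]; exact hC _ (hτX j)

theorem tri_three_one : ∫ _t in Tri 3, (1 : ℝ) = 1 / 6 := by
  rw [slice 0 _ continuous_const]
  rw [tri_poly 1 (-1) (-1) 0 0 0 0 0 0 0 0 0 0 0 0]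
  · norm_num
  · intro s
    simp [Fin.sum_univ_two]
    ring

/-- `div 𝔅₃(T)³` equals the mean-zero part of `P₂(T)`. -/
theorem stmt11 (a : Fin 4 → E3) (hind : AffineIndependent ℝ a) :
    {d : MvPolynomial (Fin 3) ℝ | ∃ v : Fin 3 → MvPolynomial (Fin 3) ℝ,
        (∀ k, (v k).totalDegree ≤ 3 ∧
          ∀ (i : Fin 4) (q : MvPolynomial (Fin 3) ℝ), q.totalDegree ≤ 1 →
            ∫ x in face a i, evalP x (v k) * evalP x q ∂(μH[2]) = 0) ∧
        d = ∑ k, MvPolynomial.pderiv k (v k)}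
      = {p : MvPolynomial (Fin 3) ℝ | p.totalDegree ≤ 2 ∧
          ∫ x in tetra a, evalP x p = 0} := by
  ext p
  constructor
  · rintro ⟨v, hv, rfl⟩
    exact ⟨totalDegree_finsetSum_le fun k _ => td_pderiv (hv k).1 k,
      div_int_zero (hind := hind) (v := v) hv⟩
  · rintro ⟨hdeg, hint⟩
    obtain ⟨d, ⟨v, hv, hvd⟩, e, he, hsum⟩ := Submodule.mem_sup.1 (span_all hind hdeg)
    obtain ⟨r, rfl⟩ := Submodule.mem_span_singleton.1 he
    have hv' : ∀ k, v k ∈ Bub a hind := fun k => hv k (Set.mem_univ k)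
    rw [divL_apply] at hvd
    have h0 := div_int_zero hv'
    rw [hvd] at h0
    obtain ⟨c, hc, h⟩ := tetra_int a hind
    rw [h] at h0 hint
    have h0' := (mul_eq_zero.1 h0).resolve_left hc
    have hint' := (mul_eq_zero.1 hint).resolve_left hc
    have hev : ∀ x : E3, evalP x p = evalP x d + r * 1 := by
      intro x; rw [← hsum]; simp [evalP]
    simp_rw [hev] at hint'
    rw [integral_add (integrable_tri (continuous_ep a d)) (integrable_tri continuous_const), h0',
      integral_const_mul, tri_three_one] at hint'
    have hr : r = 0 := by linarith
    refine ⟨v, hv', ?_⟩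
    rw [hvd, ← hsum, hr]
    simp
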